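/- Let A be the midpoint of B and B', O ≠ A with dist O B = dist O B', C with B strictly between A and C (i.e. Z(A,B,C)), and D a point with dist O D = dist O B and D on segment [O→ through C] satisfying Z(O,D,C) or Z(O,C,D). Then Z(O,D,C) holds. -/

import Mathlib

/-- Lemma 3 of the paper: with `A` the midpoint of `BB'`, `O ≠ A` equidistant
from `B` and `B'`, `B` strictly between `A` and `C`, and `D` with
`dist O D = dist O B` lying on the ray from `O` through `C` (either strictly
between `O` and `C`, or with `C` strictly between `O` and `D`), in fact `D`
lies strictly between `O` and `C`. -/
theorem point_on_ray_strictly_before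
    (O A B B' C D : EuclideanSpace ℝ (Fin 2))
    (hA : A = midpoint ℝ B B') (hOA : O ≠ A)
    (hOB : dist O B = dist O B')
    (hABC : Sbtw ℝ A B C)
    (hOD : dist O D = dist O B)
    (hray : Sbtw ℝ O D C ∨ Sbtw ℝ O C D) :
    Sbtw ℝ O D C := by
  rcases hray with h | h
  · exact h
  exfalso
  have h1 : Wbtw ℝ B' A B := by
    rw [hA, wbtw_comm]
    exact wbtw_midpoint ℝ B B'
  have h2 : Wbtw ℝ B' B C := h1.trans_expand_right hABC.wbtw hABC.left_ne
  have hne : B ≠ B' := by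
    rintro rfl
    rw [midpoint_self] at hA
    exact hABC.left_ne hA
  have h3 : Sbtw ℝ B' B C := ⟨h2, hne, hABC.ne_right⟩
  have h4 := h3.dist_lt_max_dist O
  have h5 := h.wbtw.dist_add_dist
  have h6 : 0 < dist C D := dist_pos.2 h.ne_right
  rw [dist_comm B O, dist_comm B' O, dist_comm C O, lt_max_iff] at h4
  rcases h4 with h4 | h4 <;> linarith
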